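/- The pair (G, S₂) with presentation G = ⟨a,b,c,t | ac=ca, bc=cb, act=tac, bct=tbc⟩ does not satisfy the loop shortening property: for every k > 0, the loop spelled by the word a^{2k} b^{-4k} a^{2k} t a^{-2k} b^{4k} a^{-2k} t^{-1} (of length 16k+2) admits no strictly shorter loop that synchronously k-fellow travels with it. -/

import Mathlib

/-- The word length of `g` with respect to a generating set `S`: the least `n`
such that `g` is a product of `n` elements of `S ∪ S⁻¹`. -/
noncomputable def wordLength {G : Type*} [Group G] (S : Set G) (g : G) : ℕ :=
  sInf {n | ∃ l : List G, l.length = n ∧ (∀ x ∈ l, x ∈ S ∨ x⁻¹ ∈ S) ∧ l.prod = g}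

/-- Relators of ⟨a,b,c,t | ac=ca, bc=cb, act=tac, bct=tbc⟩, with
a = 0, b = 1, c = 2, t = 3. -/
def grels : Set (FreeGroup (Fin 4)) :=
  { FreeGroup.of 0 * FreeGroup.of 2 * (FreeGroup.of 2 * FreeGroup.of 0)⁻¹,
    FreeGroup.of 1 * FreeGroup.of 2 * (FreeGroup.of 2 * FreeGroup.of 1)⁻¹,
    FreeGroup.of 0 * FreeGroup.of 2 * FreeGroup.of 3 *
      (FreeGroup.of 3 * FreeGroup.of 0 * FreeGroup.of 2)⁻¹,
    FreeGroup.of 1 * FreeGroup.of 2 * FreeGroup.of 3 *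
      (FreeGroup.of 3 * FreeGroup.of 1 * FreeGroup.of 2)⁻¹ }

/-- The group G = ⟨a,b,c,t | ac=ca, bc=cb, act=tac, bct=tbc⟩ ≅ F₂ × F₂. -/
abbrev G : Type := PresentedGroup grels

/-- The generator a of G. -/
def ga : G := PresentedGroup.of 0
/-- The generator b of G. -/
def gb : G := PresentedGroup.of 1
/-- The generator c of G. -/
def gc : G := PresentedGroup.of 2
/-- The generator t of G. -/
def gt : G := PresentedGroup.of 3

/-- The generating set S₂ = {a, b, c, t} of G. -/
def SG : Set G := {ga, gb, gc, gt}

/-- `v` is a loop of length `n` in the Cayley graph of `(G,S)`: consecutive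
vertices are at distance at most 1 and the endpoints coincide. -/
def IsLoop {G : Type*} [Group G] (S : Set G) (n : ℕ) (v : ℕ → G) : Prop :=
  v n = v 0 ∧ ∀ i < n, wordLength S ((v i)⁻¹ * v (i + 1)) ≤ 1

/-- The loop `u` (of length m) synchronously k-fellow travels with the loop `v`
(of length n): d(u_j, v_j) < k for j ≤ m and d(u_m, v_j) < k for m ≤ j ≤ n. -/
def FellowTravels {G : Type*} [Group G] (S : Set G) (k n m : ℕ)
    (v u : ℕ → G) : Prop :=
  (∀ j ≤ m, wordLength S ((u j)⁻¹ * v j) < k) ∧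
    ∀ j, m ≤ j → j ≤ n → wordLength S ((u m)⁻¹ * v j) < k

/-- The sequence of edge labels of the loop a^{2k}b^{-4k}a^{2k}ta^{-2k}b^{4k}a^{-2k}t⁻¹. -/
def loopLetters (k : ℕ) : List G :=
  List.replicate (2 * k) ga ++ List.replicate (4 * k) gb⁻¹ ++
    List.replicate (2 * k) ga ++ [gt] ++ List.replicate (2 * k) ga⁻¹ ++
    List.replicate (4 * k) gb ++ List.replicate (2 * k) ga⁻¹ ++ [gt⁻¹]

/-- The vertices of that loop: the j-th vertex is the product of the first j letters. -/
def loopVertex (k j : ℕ) : G := ((loopLetters k).take j).prod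

abbrev LState : Type := ℤ × ℤ × ℤ × ℤ

/-- Action of `a` on states. -/
def pA : Equiv.Perm LState where
  toFun s := (s.1 + 1, s.2.1, s.2.2.1, s.2.2.2 - 1)
  invFun s := (s.1 - 1, s.2.1, s.2.2.1, s.2.2.2 + 1)
  left_inv := by rintro ⟨i, r, q, c⟩; simp
  right_inv := by rintro ⟨i, r, q, c⟩; simp

/-- Action of `b` on states. -/
def pB : Equiv.Perm LState where
  toFun s := (s.1, (if s.1 = 0 then s.2.1 - 1 else s.2.1), s.2.2.1, s.2.2.2 - 1)
  invFun s := (s.1, (if s.1 = 0 then s.2.1 + 1 else s.2.1), s.2.2.1, s.2.2.2 + 1)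
  left_inv := by rintro ⟨i, r, q, c⟩; by_cases h : i = 0 <;> simp [h]
  right_inv := by rintro ⟨i, r, q, c⟩; by_cases h : i = 0 <;> simp [h]

/-- Action of `c` on states. -/
def pC : Equiv.Perm LState where
  toFun s := (s.1, s.2.1, s.2.2.1, s.2.2.2 + 1)
  invFun s := (s.1, s.2.1, s.2.2.1, s.2.2.2 - 1)
  left_inv := by rintro ⟨i, r, q, c⟩; simp
  right_inv := by rintro ⟨i, r, q, c⟩; simp

/-- Action of `t` on states. -/
def pT : Equiv.Perm LState where
  toFun s := (s.1, s.2.1, (if s.2.2.2 = 0 then s.2.2.1 + 1 else s.2.2.1), s.2.2.2)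
  invFun s := (s.1, s.2.1, (if s.2.2.2 = 0 then s.2.2.1 - 1 else s.2.2.1), s.2.2.2)
  left_inv := by rintro ⟨i, r, q, c⟩; by_cases h : c = 0 <;> simp [h]
  right_inv := by rintro ⟨i, r, q, c⟩; by_cases h : c = 0 <;> simp [h]

/-- Images of the generators. -/
def pGen : Fin 4 → Equiv.Perm LState := ![pA⁻¹, pB⁻¹, pC⁻¹, pT⁻¹]

theorem comm_AC : pA * pC = pC * pA := by
  ext1 ⟨i, r, q, c⟩; simp [pA, pC]

theorem comm_BC : pB * pC = pC * pB := by
  ext1 ⟨i, r, q, c⟩; simp [pB, pC]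

theorem comm_ACT : pC * pA * pT = pT * (pC * pA) := by
  ext1 ⟨i, r, q, c⟩; simp [pA, pC, pT]

theorem comm_BCT : pC * pB * pT = pT * (pC * pB) := by
  ext1 ⟨i, r, q, c⟩; simp [pB, pC, pT]

theorem pGen_rels : ∀ r ∈ grels, FreeGroup.lift pGen r = 1 := by
  intro r hr
  rcases hr with rfl | rfl | rfl | rfl <;>
    simp only [map_mul, map_inv, FreeGroup.lift_apply_of, mul_inv_eq_one] <;>
    simp only [pGen, Matrix.cons_val] <;>
    rw [← inv_inj] <;> simp only [mul_inv_rev, inv_inv]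
  · exact comm_AC.symm
  · exact comm_BC.symm
  · rw [← comm_ACT]; simp only [mul_assoc]
  · rw [← comm_BCT]; simp only [mul_assoc]

/-- The representation. -/
def rep : G →* Equiv.Perm LState := PresentedGroup.toGroup pGen_rels

/-- State of a group element, from base point `p`. -/
def stt (p : LState) (g : G) : LState := rep g⁻¹ p

theorem rep_a : rep ga = pA⁻¹ := PresentedGroup.toGroup.of pGen_rels
theorem rep_b : rep gb = pB⁻¹ := PresentedGroup.toGroup.of pGen_rels
theorem rep_c : rep gc = pC⁻¹ := PresentedGroup.toGroup.of pGen_rels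
theorem rep_t : rep gt = pT⁻¹ := PresentedGroup.toGroup.of pGen_rels

theorem stt_a (p g) : stt p (g * ga) = pA (stt p g) := by
  simp [stt, rep_a]
theorem stt_b (p g) : stt p (g * gb) = pB (stt p g) := by
  simp [stt, rep_b]
theorem stt_c (p g) : stt p (g * gc) = pC (stt p g) := by
  simp [stt, rep_c]
theorem stt_t (p g) : stt p (g * gt) = pT (stt p g) := by
  simp [stt, rep_t]
theorem stt_a' (p g) : stt p (g * ga⁻¹) = pA.symm (stt p g) := by
  simp [stt, rep_a]
theorem stt_b' (p g) : stt p (g * gb⁻¹) = pB.symm (stt p g) := by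
  simp [stt, rep_b]
theorem stt_t' (p g) : stt p (g * gt⁻¹) = pT.symm (stt p g) := by
  simp [stt, rep_t]

theorem SG_exists (g : G) :
    ∃ l : List G, (∀ x ∈ l, x ∈ SG ∨ x⁻¹ ∈ SG) ∧ l.prod = g := by
  have h : g ∈ Subgroup.closure SG := by
    have h2 := PresentedGroup.closure_range_of grels
    have : Set.range (PresentedGroup.of (rels := grels)) ⊆ SG := by
      rintro _ ⟨i, rfl⟩
      fin_cases i <;> simp [SG, ga, gb, gc, gt]
    have h3 := Subgroup.closure_mono this
    rw [h2] at h3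
    exact h3 trivial
  rw [← Subgroup.mem_toSubmonoid, Subgroup.closure_toSubmonoid] at h
  obtain ⟨l, h1, h2⟩ := Submonoid.exists_list_of_mem_closure h
  exact ⟨l, fun x hx => by simpa using h1 x hx, h2⟩

theorem SG_attained (g : G) :
    ∃ l : List G, l.length = wordLength SG g ∧ (∀ x ∈ l, x ∈ SG ∨ x⁻¹ ∈ SG) ∧ l.prod = g := by
  obtain ⟨l, h1, h2⟩ := SG_exists g
  exact Nat.sInf_mem (s := {n | ∃ l : List G, l.length = n ∧ (∀ x ∈ l, x ∈ SG ∨ x⁻¹ ∈ SG) ∧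
    l.prod = g}) ⟨_, l, rfl, h1, h2⟩

theorem lip_list (F : G → ℤ) (hF : ∀ g, ∀ s ∈ SG, |F (g * s) - F g| ≤ 1) (l : List G) :
    ∀ g : G, (∀ x ∈ l, x ∈ SG ∨ x⁻¹ ∈ SG) → |F (g * l.prod) - F g| ≤ l.length := by
  induction l with
  | nil => intro g _; simp
  | cons x l ih =>
    intro g hl
    have h1 := ih (g * x) (fun y hy => hl y (List.mem_cons_of_mem _ hy))
    have h2 : |F (g * x) - F g| ≤ 1 := by
      rcases hl x List.mem_cons_self with h | h
      · exact hF g x h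
      · have := hF (g * x) _ h
        rw [mul_inv_cancel_right, abs_sub_comm] at this
        exact this
    rw [List.prod_cons, ← mul_assoc, List.length_cons]
    push_cast
    rw [abs_le] at *
    omega

theorem lip (F : G → ℤ) (hF : ∀ g, ∀ s ∈ SG, |F (g * s) - F g| ≤ 1) (u v : G) :
    |F v - F u| ≤ wordLength SG (u⁻¹ * v) := by
  obtain ⟨l, h1, h2, h3⟩ := SG_attained (u⁻¹ * v)
  have := lip_list F hF l u h2
  rw [h1, h3, mul_inv_cancel_left] at this
  exact this

theorem lip_state (p : LState) (f : LState → ℤ) (hA : ∀ s, |f (pA s) - f s| ≤ 1)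
    (hB : ∀ s, |f (pB s) - f s| ≤ 1) (hC : ∀ s, |f (pC s) - f s| ≤ 1)
    (hT : ∀ s, |f (pT s) - f s| ≤ 1) (u v : G) :
    |f (stt p v) - f (stt p u)| ≤ wordLength SG (u⁻¹ * v) := by
  refine lip (fun g => f (stt p g)) ?_ u v
  rintro g s (rfl | rfl | rfl | rfl)
  · simpa only [stt_a] using hA _
  · simpa only [stt_b] using hB _
  · simpa only [stt_c] using hC _
  · simpa only [stt_t] using hT _

/-- Main potential. -/
def fPsi (s : LState) : ℤ := 2 * s.2.1 - s.2.2.2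
/-- Potential for the start. -/
def fLam (s : LState) : ℤ := 2 * (if s.2.1 ≤ 0 then min s.1 0 else 0) + s.2.2.2
/-- Potential for the middle. -/
def fMu (N : ℤ) (s : LState) : ℤ := 2 * (if N ≤ s.2.1 then max s.1 0 else 0) + s.2.2.2
/-- Signed distance to the crossing. -/
def fKap (s : LState) : ℤ := if s.2.2.1 ≤ 0 then |s.2.2.2| else -|s.2.2.2|

theorem lip_Psi (p u v) : |fPsi (stt p v) - fPsi (stt p u)| ≤ wordLength SG (u⁻¹ * v) := by
  apply lip_state <;> rintro ⟨i, r, q, c⟩ <;> simp only [fPsi, pA, pB, pC, pT, Equiv.coe_fn_mk] <;>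
    rw [abs_le] <;> (try split_ifs) <;> omega

theorem lip_Lam (p u v) : |fLam (stt p v) - fLam (stt p u)| ≤ wordLength SG (u⁻¹ * v) := by
  apply lip_state <;> rintro ⟨i, r, q, c⟩ <;> simp only [fLam, pA, pB, pC, pT, Equiv.coe_fn_mk] <;>
    rw [abs_le] <;> (try split_ifs) <;> omega

theorem lip_Mu (N p u v) :
    |fMu N (stt p v) - fMu N (stt p u)| ≤ wordLength SG (u⁻¹ * v) := by
  apply lip_state <;> rintro ⟨i, r, q, c⟩ <;> simp only [fMu, pA, pB, pC, pT, Equiv.coe_fn_mk] <;>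
    rw [abs_le] <;> (try split_ifs) <;> omega

theorem lip_Kap (p u v) : |fKap (stt p v) - fKap (stt p u)| ≤ wordLength SG (u⁻¹ * v) := by
  apply lip_state <;> rintro ⟨i, r, q, c⟩ <;> simp only [fKap, pA, pB, pC, pT, Equiv.coe_fn_mk] <;>
    grind

/-- A step changing `q` happens with `c = 0` and fixes everything else. -/
theorem step_q (p : LState) (u v : G) (h : wordLength SG (u⁻¹ * v) ≤ 1)
    (hq : (stt p u).2.2.1 ≠ (stt p v).2.2.1) :
    (stt p u).2.2.2 = 0 ∧ (stt p v).2.2.2 = 0 ∧ (stt p u).2.1 = (stt p v).2.1 := by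
  obtain ⟨l, h1, h2, h3⟩ := SG_attained (u⁻¹ * v)
  rw [← h1] at h
  have key : ∀ g : G, ∀ s ∈ SG, (stt p g).2.2.1 ≠ (stt p (g * s)).2.2.1 →
      (stt p g).2.2.2 = 0 ∧ (stt p (g * s)).2.2.2 = 0 ∧
        (stt p g).2.1 = (stt p (g * s)).2.1 := by
    rintro g s (rfl | rfl | rfl | rfl)
    · simp [stt_a, pA]
    · simp [stt_b, pB]
    · simp [stt_c, pC]
    · simp only [stt_t, pT, Equiv.coe_fn_mk]
      grind
  match l, h with
  | [], _ =>
    simp only [List.prod_nil] at h3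
    have : u = v := by rw [eq_comm, inv_mul_eq_one] at h3; exact h3
    subst this
    exact absurd rfl hq
  | [x], _ =>
    simp only [List.prod_singleton] at h3
    have hv : v = u * x := by rw [h3]; group
    have hu : u = v * x⁻¹ := by rw [hv]; group
    rcases h2 x (by simp) with h | h
    · have := key u x h
      rw [← hv] at this
      exact this hq
    · have := key v x⁻¹ h
      rw [← hu] at this
      have := this hq.symm
      exact ⟨this.2.1, this.1, this.2.2.symm⟩

/-- Explicit state of the `j`-th vertex. -/
def vst (k j : ℤ) : LState :=
  if j ≤ 2 * k then (-2 * k + j, 0, 0, -j)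
  else if j ≤ 6 * k then (0, j - 2 * k, 0, j - 4 * k)
  else if j ≤ 8 * k then (j - 6 * k, 4 * k, 0, 8 * k - j)
  else if j ≤ 10 * k + 1 then (10 * k + 1 - j, 4 * k, 1, j - 8 * k - 1)
  else if j ≤ 14 * k + 1 then (0, 14 * k + 1 - j, 1, 12 * k + 1 - j)
  else if j ≤ 16 * k + 1 then (14 * k + 1 - j, 0, 1, j - 16 * k - 1)
  else (-2 * k, 0, 0, 0)

theorem state_ext {i r q c i2 r2 q2 c2 : ℤ} (h1 : i = i2) (h2 : r = r2) (h3 : q = q2)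
    (h4 : c = c2) : ((i, r, q, c) : LState) = (i2, r2, q2, c2) := by
  rw [h1, h2, h3, h4]

theorem vst1 (k j : ℤ) (h : j ≤ 2 * k) : vst k j = (-2 * k + j, 0, 0, -j) := by
  unfold vst; rw [if_pos h]

theorem vst2 (k j : ℤ) (h : 2 * k ≤ j) (h' : j ≤ 6 * k) :
    vst k j = (0, j - 2 * k, 0, j - 4 * k) := by
  unfold vst; split_ifs <;> refine state_ext ?_ ?_ ?_ ?_ <;> omega

theorem vst3 (k j : ℤ) (hk : 0 < k) (h : 6 * k ≤ j) (h' : j ≤ 8 * k) :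
    vst k j = (j - 6 * k, 4 * k, 0, 8 * k - j) := by
  unfold vst; split_ifs <;> refine state_ext ?_ ?_ ?_ ?_ <;> omega

theorem vst4 (k j : ℤ) (hk : 0 < k) (h : 8 * k + 1 ≤ j) (h' : j ≤ 10 * k + 1) :
    vst k j = (10 * k + 1 - j, 4 * k, 1, j - 8 * k - 1) := by
  unfold vst; split_ifs <;> refine state_ext ?_ ?_ ?_ ?_ <;> omega

theorem vst5 (k j : ℤ) (hk : 0 < k) (h : 10 * k + 1 ≤ j) (h' : j ≤ 14 * k + 1) :
    vst k j = (0, 14 * k + 1 - j, 1, 12 * k + 1 - j) := by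
  unfold vst; split_ifs <;> refine state_ext ?_ ?_ ?_ ?_ <;> omega

theorem vst6 (k j : ℤ) (hk : 0 < k) (h : 14 * k + 1 ≤ j) (h' : j ≤ 16 * k + 1) :
    vst k j = (14 * k + 1 - j, 0, 1, j - 16 * k - 1) := by
  unfold vst; split_ifs <;> refine state_ext ?_ ?_ ?_ ?_ <;> omega

theorem vst7 (k j : ℤ) (hk : 0 < k) (h : 16 * k + 2 ≤ j) :
    vst k j = (-2 * k, 0, 0, 0) := by
  unfold vst; split_ifs <;> refine state_ext ?_ ?_ ?_ ?_ <;> omega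

theorem letter (k j : ℕ) (hj : j < 16 * k + 2) : (loopLetters k)[j]? =
    some (if j < 2 * k then ga else if j < 6 * k then gb⁻¹ else if j < 8 * k then ga
      else if j < 8 * k + 1 then gt else if j < 10 * k + 1 then ga⁻¹
      else if j < 14 * k + 1 then gb else if j < 16 * k + 1 then ga⁻¹ else gt⁻¹) := by
  simp only [loopLetters, List.getElem?_append, List.length_append, List.length_replicate,
    List.length_singleton, List.getElem?_replicate, List.getElem?_singleton]
  grind

theorem vertex_state (k : ℕ) (hk : 0 < k) (j : ℕ) (hj : j ≤ 16 * k + 2) :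
    stt (-2 * k, 0, 0, 0) (loopVertex k j) = vst k j := by
  induction j with
  | zero =>
    have : (0 : ℤ) ≤ 2 * k := by omega
    simp [loopVertex, stt, vst]
  | succ j ih =>
    have ih := ih (by omega)
    have hs : ∀ x, (loopLetters k)[j]? = some x →
        loopVertex k (j + 1) = loopVertex k j * x := by
      intro x hx
      rw [loopVertex, List.take_add_one, hx, Option.toList_some,
        List.prod_append, List.prod_singleton]
      rfl
    have hl := hs _ (letter k j (by omega))
    rw [hl]
    push_cast
    split_ifs
    · rw [stt_a, ih, vst1 _ _ (by omega), vst1 _ _ (by omega)]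
      simp only [pA, Equiv.coe_fn_mk]
      refine state_ext ?_ ?_ ?_ ?_ <;> omega
    · rw [stt_b', ih, vst2 _ _ (by omega) (by omega), vst2 _ _ (by omega) (by omega)]
      simp only [pB, Equiv.coe_fn_symm_mk, if_true]
      refine state_ext ?_ ?_ ?_ ?_ <;> omega
    · rw [stt_a, ih, vst3 _ _ (by omega) (by omega) (by omega),
        vst3 _ _ (by omega) (by omega) (by omega)]
      simp only [pA, Equiv.coe_fn_mk]
      refine state_ext ?_ ?_ ?_ ?_ <;> omega
    · rw [stt_t, ih, vst3 _ _ (by omega) (by omega) (by omega),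
        vst4 _ _ (by omega) (by omega) (by omega)]
      simp only [pT, Equiv.coe_fn_mk]
      rw [if_pos (by omega)]
      refine state_ext ?_ ?_ ?_ ?_ <;> omega
    · rw [stt_a', ih, vst4 _ _ (by omega) (by omega) (by omega),
        vst4 _ _ (by omega) (by omega) (by omega)]
      simp only [pA, Equiv.coe_fn_symm_mk]
      refine state_ext ?_ ?_ ?_ ?_ <;> omega
    · rw [stt_b, ih, vst5 _ _ (by omega) (by omega) (by omega),
        vst5 _ _ (by omega) (by omega) (by omega)]
      simp only [pB, Equiv.coe_fn_mk, if_true]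
      refine state_ext ?_ ?_ ?_ ?_ <;> omega
    · rw [stt_a', ih, vst6 _ _ (by omega) (by omega) (by omega),
        vst6 _ _ (by omega) (by omega) (by omega)]
      simp only [pA, Equiv.coe_fn_symm_mk]
      refine state_ext ?_ ?_ ?_ ?_ <;> omega
    · rw [stt_t', ih, vst6 _ _ (by omega) (by omega) (by omega),
        vst7 _ _ (by omega) (by omega)]
      simp only [pT, Equiv.coe_fn_symm_mk]
      rw [if_pos (by omega)]
      refine state_ext ?_ ?_ ?_ ?_ <;> omega

theorem vst_Lam (k s : ℕ) (hs : s ≤ 2 * k ∨ 14 * k + 1 ≤ s ∧ s < 16 * k + 2) :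
    fLam (vst k s) ≤ -2 * k := by
  unfold vst
  split_ifs <;> simp only [fLam] <;> (try split_ifs) <;> omega

theorem vst_Mu (k s : ℕ) (hk : 0 < k) (hs : 6 * k ≤ s ∧ s ≤ 10 * k + 1) :
    2 * (k : ℤ) ≤ fMu (4 * k) (vst k s) := by
  unfold vst
  split_ifs <;> simp only [fMu] <;> (try split_ifs) <;> omega

theorem crossing (q : ℕ → ℤ) (x n : ℕ) (hxn : x ≤ n) (P : ℤ → Prop) (h0 : P (q x)) (h1 : ¬ P (q n)) :
    ∃ s, x ≤ s ∧ s < n ∧ P (q s) ∧ ¬ P (q (s + 1)) := by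
  by_contra! hc
  have : ∀ d, x + d ≤ n → P (q (x + d)) := by
    intro d
    induction d with
    | zero => intro _; exact h0
    | succ d ih => intro hd; exact hc (x + d) (by omega) (by omega) (ih (by omega))
  apply h1
  have := this (n - x) (by omega)
  rwa [Nat.add_sub_cancel' hxn] at this

theorem lip_seq (f : ℕ → ℤ) (n : ℕ) (hf : ∀ i < n, |f (i + 1) - f i| ≤ 1) (x d : ℕ)
    (h : x + d ≤ n) : |f (x + d) - f x| ≤ d := by
  induction d with
  | zero => simp
  | succ d ih =>
    have h1 := ih (by omega)
    have h2 := hf (x + d) (by omega)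
    rw [abs_le] at *
    rw [← add_assoc]
    push_cast
    omega

theorem lip_seq' (f : ℕ → ℤ) (n : ℕ) (hf : ∀ i < n, |f (i + 1) - f i| ≤ 1) (x y : ℕ)
    (hxy : x ≤ y) (h : y ≤ n) : |f y - f x| ≤ (y : ℤ) - x := by
  have := lip_seq f n hf x (y - x) (by omega)
  rw [Nat.add_sub_cancel' hxy] at this
  push_cast [hxy] at this
  exact this

theorem wl_one : wordLength SG (1 : G) = 0 :=
  Nat.le_zero.1 (Nat.sInf_le ⟨[], rfl, by simp, rfl⟩)

set_option maxHeartbeats 1000000 in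
theorem main_aux (k : ℕ) (hk : 0 < k) (w : ℕ → G)
    (hstep : ∀ i < 16 * k + 2, wordLength SG ((w i)⁻¹ * w (i + 1)) ≤ 1)
    (hloop : w (16 * k + 2) = w 0) (hlast : w (16 * k + 1) = w (16 * k + 2))
    (hd : ∀ j ≤ 16 * k + 2, wordLength SG ((w j)⁻¹ * loopVertex k j) < k) : False := by
  obtain ⟨σ, hσ⟩ : ∃ σ : ℕ → LState, σ = fun j => stt (-2 * k, 0, 0, 0) (w j) := ⟨_, rfl⟩
  have hσ' : ∀ j, stt (-2 * k, 0, 0, 0) (w j) = σ j := fun j => by rw [hσ]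
  have hPsi : ∀ i < 16 * k + 2, |fPsi (σ (i + 1)) - fPsi (σ i)| ≤ 1 := by
    intro i hi
    have h1 := lip_Psi (-2 * k, 0, 0, 0) (w i) (w (i + 1))
    rw [hσ', hσ'] at h1
    have := hstep i hi
    omega
  have hPL := lip_seq' (fun j => fPsi (σ j)) _ hPsi
  have hLam : ∀ j ≤ 16 * k + 2, |fLam (vst k j) - fLam (σ j)| < k := by
    intro j hj
    have h1 := lip_Lam (-2 * k, 0, 0, 0) (w j) (loopVertex k j)
    rw [hσ', vertex_state k hk j hj] at h1
    have := hd j hj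
    omega
  have hMu : ∀ j ≤ 16 * k + 2, |fMu (4 * k) (vst k j) - fMu (4 * k) (σ j)| < k := by
    intro j hj
    have h1 := lip_Mu (4 * k) (-2 * k, 0, 0, 0) (w j) (loopVertex k j)
    rw [hσ', vertex_state k hk j hj] at h1
    have := hd j hj
    omega
  have hKap : ∀ j ≤ 16 * k + 2, |fKap (vst k j) - fKap (σ j)| < k := by
    intro j hj
    have h1 := lip_Kap (-2 * k, 0, 0, 0) (w j) (loopVertex k j)
    rw [hσ', vertex_state k hk j hj] at h1
    have := hd j hj
    omega
  have hQ : ∀ i < 16 * k + 2, (σ i).2.2.1 ≠ (σ (i + 1)).2.2.1 →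
      (σ i).2.2.2 = 0 ∧ (σ (i + 1)).2.2.2 = 0 ∧ (σ i).2.1 = (σ (i + 1)).2.1 := by
    intro i hi
    have := step_q (-2 * k, 0, 0, 0) (w i) (w (i + 1)) (hstep i hi)
    rwa [hσ', hσ'] at this
  have hL : σ (16 * k + 2) = σ 0 := by rw [hσ]; simp only [hloop]
  have hE : σ (16 * k + 1) = σ (16 * k + 2) := by rw [hσ]; simp only [hlast]
  clear hσ hσ' hstep hloop hlast hd
  have hk' : (0 : ℤ) < k := by omega
  have q1 : (σ (2 * k)).2.2.1 ≤ 0 := by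
    have h := hKap (2 * k) (by omega)
    have e : fKap (vst k (2 * k : ℕ)) = 2 * k := by
      simp only [vst, fKap]; push_cast; grind
    rw [e] at h; simp only [fKap] at h; grind
  have q2 : (σ (6 * k)).2.2.1 ≤ 0 := by
    have h := hKap (6 * k) (by omega)
    have e : fKap (vst k (6 * k : ℕ)) = 2 * k := by
      simp only [vst, fKap]; push_cast; grind
    rw [e] at h; simp only [fKap] at h; grind
  have q3 : ¬ (σ (10 * k + 1)).2.2.1 ≤ 0 := by
    have h := hKap (10 * k + 1) (by omega)
    have e : fKap (vst k (10 * k + 1 : ℕ)) = - (2 * k) := by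
      simp only [vst, fKap]; push_cast; grind
    rw [e] at h; simp only [fKap] at h; grind
  have q4 : ¬ (σ (14 * k + 1)).2.2.1 ≤ 0 := by
    have h := hKap (14 * k + 1) (by omega)
    have e : fKap (vst k (14 * k + 1 : ℕ)) = - (2 * k) := by
      simp only [vst, fKap]; push_cast; grind
    rw [e] at h; simp only [fKap] at h; grind
  have r0 : ∀ s, (s ≤ 2 * k ∨ 14 * k + 1 ≤ s ∧ s < 16 * k + 2) → (σ s).2.2.2 = 0 →
      (σ s).2.1 ≤ 0 := by
    intro s hs hc
    by_contra hr
    have h := hLam s (by omega)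
    have e : fLam (σ s) = 0 := by simp only [fLam]; rw [if_neg hr, hc]; rfl
    have e2 : fLam (vst k s) ≤ -2 * k := vst_Lam k s hs
    rw [e, abs_lt] at h; omega
  have r1 : ∀ s, (6 * k ≤ s ∧ s ≤ 10 * k + 1) → (σ s).2.2.2 = 0 →
      4 * (k : ℤ) ≤ (σ s).2.1 := by
    intro s hs hc
    by_contra hr
    have h := hMu s (by omega)
    have e : fMu (4 * k) (σ s) = 0 := by simp only [fMu]; rw [if_neg hr, hc]; rfl
    have e2 : 2 * (k : ℤ) ≤ fMu (4 * k) (vst k s) := vst_Mu k s hk hs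
    rw [e, abs_lt] at h; omega
  obtain ⟨s, hs1, hs2, hs3, hs4⟩ := crossing (fun j => (σ j).2.2.1) (6 * k) (10 * k + 1) (by omega)
    (fun z => z ≤ 0) q2 q3
  obtain ⟨c1, c2, c3⟩ := hQ s (by omega) (by intro h; rw [h] at hs3; exact hs4 hs3)
  have R1 := r1 s (by omega) c1
  have P1 : 8 * (k : ℤ) ≤ fPsi (σ s) := by simp only [fPsi]; omega
  have P2 : 8 * (k : ℤ) ≤ fPsi (σ (s + 1)) := by simp only [fPsi]; omega
  by_cases hq : (σ (16 * k + 2)).2.2.1 ≤ 0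
  · obtain ⟨z, hz1, hz2, hz3, hz4⟩ := crossing (fun j => (σ j).2.2.1) (14 * k + 1) (16 * k + 2)
      (by omega) (fun z => ¬ z ≤ 0) q4 (by simpa using hq)
    simp only [not_not] at hz3 hz4
    obtain ⟨d1, d2, d3⟩ := hQ z (by omega) (by omega)
    have R2 := r0 z (by omega) d1
    have hz : z ≠ 16 * k + 1 := by
      rintro rfl
      rw [hE] at hz3; exact hz3 hz4
    have P3 : fPsi (σ z) ≤ 0 := by simp only [fPsi]; omega
    have P4 : fPsi (σ (z + 1)) ≤ 0 := by simp only [fPsi]; omega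
    have b1 := hPL (s + 1) z (by omega) (by omega)
    have b2 := hPL (z + 1) (16 * k + 1) (by omega) (by omega)
    have b3 := hPL 0 s (by omega) (by omega)
    simp only [hE, hL] at b2
    simp only [abs_le] at b1 b2 b3
    push_cast at *
    omega
  · obtain ⟨z, hz1, hz2, hz3, hz4⟩ := crossing (fun j => (σ j).2.2.1) 0 (2 * k)
      (by omega) (fun z => ¬ z ≤ 0) (by rw [← hL]; exact hq) (by simpa using q1)
    simp only [not_not] at hz3 hz4
    obtain ⟨d1, d2, d3⟩ := hQ z (by omega) (by omega)
    have R2 := r0 z (by omega) d1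
    have P3 : fPsi (σ z) ≤ 0 := by simp only [fPsi]; omega
    have P4 : fPsi (σ (z + 1)) ≤ 0 := by simp only [fPsi]; omega
    have b1 := hPL (z + 1) s (by omega) (by omega)
    have b2 := hPL (s + 1) (16 * k + 1) (by omega) (by omega)
    have b3 := hPL 0 z (by omega) (by omega)
    simp only [hE, hL] at b2
    simp only [abs_le] at b1 b2 b3
    push_cast at *
    omega

theorem stmt18 (k : ℕ) (hk : 0 < k) :
    ¬ ∃ (m : ℕ) (u : ℕ → G), m < 16 * k + 2 ∧ IsLoop SG m u ∧
      FellowTravels SG k (16 * k + 2) m (loopVertex k) u := by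
  rintro ⟨m, u, hm, ⟨hl, hs⟩, hf1, hf2⟩
  refine main_aux k hk (fun j => u (min j m)) ?_ ?_ ?_ ?_
  · intro i _
    by_cases h : i < m
    · simp only [min_eq_left h.le, min_eq_left (Nat.succ_le_of_lt h)]
      exact hs i h
    · simp only [min_eq_right (not_lt.1 h), min_eq_right (show m ≤ i + 1 by omega)]
      simp [wl_one]
  · simp only [min_eq_right hm.le, Nat.zero_min, hl]
  · simp only [min_eq_right hm.le, min_eq_right (show m ≤ 16 * k + 1 by omega)]
  · intro j hj
    by_cases h : j ≤ m
    · simp only [min_eq_left h]; exact hf1 j h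
    · simp only [min_eq_right (show m ≤ j by omega)]; exact hf2 j (by omega) hj
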